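/- Let 𝒯 be a finite undirected tree, w : V(𝒯) → ℝ≥0 a weight function, and let C be a centroid tree of (𝒯,w). For every ε > 0 there exists a weight function w′ : V(𝒯) → ℝ≥0 such that C is the unique centroid tree of (𝒯,w′) and ‖w′ − w‖_∞ < ε, i.e., |w′(x) − w(x)| < ε for every vertex x. -/

import Mathlib

open Filter Topology

universe u

variable {V : Type u}

/-- Rooted trees with vertices labelled by elements of `V`. -/
inductive RTree (V : Type u) : Type u where
  | node : V → List (RTree V) → RTree V

namespace RTree

/-- The root of a rooted tree. -/
def root : RTree V → V
  | node r _ => r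

/-- The subtrees rooted at the children of the root. -/
def children : RTree V → List (RTree V)
  | node _ ts => ts

/-- The list of pairs `(v, path from the root to v)` over all vertices `v` of the tree. -/
def pathsFrom : RTree V → List (V × List V)
  | node r ts =>
      (r, [r]) ::
        (ts.attach.map fun t => (t.1.pathsFrom.map fun p => (p.1, r :: p.2))).flatten
  decreasing_by
    simp only [RTree.node.sizeOf_spec]
    have := List.sizeOf_lt_of_mem t.2
    omega

/-- The vertex set of a rooted tree. -/
def vertSet (T : RTree V) : Set V := {v | ∃ p ∈ T.pathsFrom, p.1 = v}

/-- `Path_T(v)`: the set of vertices on the path in `T` from the root to `v`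
(including both endpoints). -/
def pathSet (T : RTree V) (v : V) : Set V := {x | ∃ p ∈ T.pathsFrom, p.1 = v ∧ x ∈ p.2}

/-- The depth of a vertex `v` in `T`; the root has depth 1. -/
noncomputable def depth (T : RTree V) (v : V) : ℕ := (T.pathSet v).ncard

/-- All subtrees of a rooted tree (including the tree itself). -/
def allSubtrees : RTree V → List (RTree V)
  | node r ts => node r ts :: (ts.attach.map fun t => t.1.allSubtrees).flatten
  decreasing_by
    simp only [RTree.node.sizeOf_spec]
    have := List.sizeOf_lt_of_mem t.2
    omega

/-- Two rooted trees are equivalent (represent the same search tree) if they have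
the same root-to-vertex paths. -/
def Equiv (T₁ T₂ : RTree V) : Prop := ∀ v, T₁.pathSet v = T₂.pathSet v

end RTree

/-- `x` and `y` are joined by a walk of `G` staying inside `s`. -/
def ReachIn (G : SimpleGraph V) (s : Set V) (x y : V) : Prop :=
  ∃ p : G.Walk x y, ∀ v ∈ p.support, v ∈ s

/-- The connected component of `x` in the subgraph of `G` induced by `s`. -/
def compIn (G : SimpleGraph V) (s : Set V) (x : V) : Set V := {y | ReachIn G s x y}

/-- The set of connected components of the subgraph of `G` induced by `s`. -/
def comps (G : SimpleGraph V) (s : Set V) : Set (Set V) := {c | ∃ x ∈ s, c = compIn G s x}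

/-- `s` induces a (nonempty) connected subgraph of `G`. -/
def ConnIn (G : SimpleGraph V) (s : Set V) : Prop :=
  s.Nonempty ∧ ∀ x ∈ s, ∀ y ∈ s, ReachIn G s x y

/-- The total weight of a set of vertices. -/
noncomputable def wsum (w : V → ℝ) (s : Set V) : ℝ := ∑ᶠ x ∈ s, w x

/-- `IsSearchTree G s T`: `T` is a search tree on the subgraph of `G` induced by `s`.
Its root `r` is a vertex of `s`, its vertex set is `s`, and the subtrees rooted at the
children of `r` are search trees on the connected components of the induced subgraph
on `s \ {r}` (one subtree for each component). -/
inductive IsSearchTree (G : SimpleGraph V) : Set V → RTree V → Prop where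
  | node {s : Set V} {r : V} {ts : List (RTree V)} :
      r ∈ s →
      (RTree.node r ts).vertSet = s →
      (∀ t ∈ ts, IsSearchTree G (compIn G (s \ {r}) t.root) t) →
      ts.Pairwise (fun t₁ t₂ => compIn G (s \ {r}) t₁.root ≠ compIn G (s \ {r}) t₂.root) →
      IsSearchTree G s (RTree.node r ts)

/-- The cost of a search tree: `∑_x w(x) · depth(x)`, the root having depth 1. -/
noncomputable def cost (w : V → ℝ) (T : RTree V) : ℝ :=
  ∑ᶠ v ∈ T.vertSet, w v * (T.depth v : ℝ)

/-- The optimum cost of a search tree on the subgraph of `G` induced by `s`. -/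
noncomputable def OPT (G : SimpleGraph V) (w : V → ℝ) (s : Set V) : ℝ :=
  sInf (cost w '' {T | IsSearchTree G s T})

/-- `v` is an `α`-centroid of the subgraph of `G` induced by `s` (with weights `w`):
every connected component of the induced subgraph on `s \ {v}` has weight at most
`α` times the weight of `s`. -/
def IsAlphaCentroid (G : SimpleGraph V) (w : V → ℝ) (α : ℝ) (s : Set V) (v : V) : Prop :=
  v ∈ s ∧ ∀ x ∈ s \ {v}, wsum w (compIn G (s \ {v}) x) ≤ α * wsum w s

/-- `v` is a centroid of the subgraph of `G` induced by `s` (with weights `w`). -/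
def IsCentroid (G : SimpleGraph V) (w : V → ℝ) (s : Set V) (v : V) : Prop :=
  v ∈ s ∧ ∀ x ∈ s \ {v}, wsum w (compIn G (s \ {v}) x) ≤ wsum w s / 2

/-- `T` is an `α`-centroid tree on the subgraph of `G` induced by `s`. -/
def IsAlphaCentroidTree (G : SimpleGraph V) (w : V → ℝ) (α : ℝ) (s : Set V) (T : RTree V) :
    Prop :=
  IsSearchTree G s T ∧ ∀ t ∈ T.allSubtrees, IsAlphaCentroid G w α t.vertSet t.root

/-- `T` is a centroid tree on the subgraph of `G` induced by `s`. -/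
def IsCentroidTree (G : SimpleGraph V) (w : V → ℝ) (s : Set V) (T : RTree V) : Prop :=
  IsSearchTree G s T ∧ ∀ t ∈ T.allSubtrees, IsCentroid G w t.vertSet t.root

/-- `cent(𝒯,w)`: the maximum cost of a centroid tree. -/
noncomputable def centCost (G : SimpleGraph V) (w : V → ℝ) (s : Set V) : ℝ :=
  sSup (cost w '' {T | IsCentroidTree G w s T})

/-- `centᵅ(𝒯,w)`: the maximum cost of an `α`-centroid tree (`0` if none exists, since
`sSup ∅ = 0` in `ℝ`). -/
noncomputable def centCostA (G : SimpleGraph V) (w : V → ℝ) (α : ℝ) (s : Set V) : ℝ :=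
  sSup (cost w '' {T | IsAlphaCentroidTree G w α s T})

/-- `b` is a child of `a` in the rooted tree `T`. -/
def ChildRel (T : RTree V) (a b : V) : Prop :=
  ∃ t ∈ T.allSubtrees, t.root = a ∧ ∃ t' ∈ t.children, t'.root = b

namespace RTree

theorem mem_vertSet_node {r : V} {ts : List (RTree V)} {v : V} :
    v ∈ (node r ts).vertSet ↔ v = r ∨ ∃ t ∈ ts, v ∈ t.vertSet := by
  simp only [vertSet, Set.mem_ofPred_eq]
  rw [pathsFrom]
  constructor
  · rintro ⟨p, hp, rfl⟩
    simp only [List.mem_cons, List.mem_flatten, List.mem_map, List.mem_attach, true_and,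
      Subtype.exists] at hp
    rcases hp with rfl | ⟨_, ⟨t, ht, rfl⟩, hp⟩
    · exact Or.inl rfl
    · obtain ⟨q, hq, rfl⟩ := List.mem_map.1 hp
      exact Or.inr ⟨t, ht, q, hq, rfl⟩
  · rintro (rfl | ⟨t, ht, q, hq, rfl⟩)
    · exact ⟨_, List.mem_cons_self, rfl⟩
    · refine ⟨(q.1, r :: q.2), List.mem_cons_of_mem _ (List.mem_flatten.2 ⟨_,
        List.mem_map.2 ⟨⟨t, ht⟩, List.mem_attach _ _, rfl⟩, List.mem_map.2 ⟨q, hq, rfl⟩⟩), rfl⟩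

theorem mem_pathSet_node {r : V} {ts : List (RTree V)} {v x : V} :
    x ∈ (node r ts).pathSet v ↔
      (v = r ∧ x = r) ∨ ∃ t ∈ ts, v ∈ t.vertSet ∧ (x = r ∨ x ∈ t.pathSet v) := by
  simp only [pathSet, vertSet, Set.mem_ofPred_eq]
  rw [pathsFrom]
  constructor
  · rintro ⟨p, hp, rfl, hx⟩
    simp only [List.mem_cons, List.mem_flatten, List.mem_map, List.mem_attach, true_and,
      Subtype.exists] at hp
    rcases hp with rfl | ⟨_, ⟨t, ht, rfl⟩, hp⟩
    · exact Or.inl ⟨rfl, by simpa using hx⟩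
    · obtain ⟨q, hq, rfl⟩ := List.mem_map.1 hp
      refine Or.inr ⟨t, ht, ⟨q, hq, rfl⟩, ?_⟩
      rcases List.mem_cons.1 hx with h | h
      · exact Or.inl h
      · exact Or.inr ⟨q, hq, rfl, h⟩
  · have lift : ∀ t ∈ ts, ∀ q ∈ t.pathsFrom, (q.1, r :: q.2) ∈ (r, [r]) ::
        (ts.attach.map fun t => (t.1.pathsFrom.map fun p => (p.1, r :: p.2))).flatten :=
      fun t ht q hq => List.mem_cons_of_mem _ (List.mem_flatten.2 ⟨_,
        List.mem_map.2 ⟨⟨t, ht⟩, List.mem_attach _ _, rfl⟩, List.mem_map.2 ⟨q, hq, rfl⟩⟩)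
    rintro (⟨rfl, rfl⟩ | ⟨t, ht, ⟨q, hq, rfl⟩, rfl | ⟨p, hp, hpq, hx⟩⟩)
    · exact ⟨_, List.mem_cons_self, rfl, by simp⟩
    · exact ⟨_, lift t ht q hq, rfl, by simp⟩
    · exact ⟨_, lift t ht p hp, hpq, by simp [hx]⟩

theorem mem_allSubtrees_node {r : V} {ts : List (RTree V)} {t : RTree V} :
    t ∈ (node r ts).allSubtrees ↔ t = node r ts ∨ ∃ u ∈ ts, t ∈ u.allSubtrees := by
  rw [allSubtrees]
  simp

theorem self_mem_allSubtrees (t : RTree V) : t ∈ t.allSubtrees := by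
  cases t
  exact mem_allSubtrees_node.2 (Or.inl rfl)

theorem root_mem_vertSet (t : RTree V) : t.root ∈ t.vertSet := by
  cases t
  exact mem_vertSet_node.2 (Or.inl rfl)

end RTree

section Reach

variable {G : SimpleGraph V} {s : Set V} {x y z : V}

theorem ReachIn.left_mem (h : ReachIn G s x y) : x ∈ s := by
  obtain ⟨p, hp⟩ := h
  exact hp _ p.start_mem_support

theorem ReachIn.right_mem (h : ReachIn G s x y) : y ∈ s := by
  obtain ⟨p, hp⟩ := h
  exact hp _ p.end_mem_support

theorem ReachIn.refl (h : x ∈ s) : ReachIn G s x x :=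
  ⟨.nil, by simpa using h⟩

theorem ReachIn.symm (h : ReachIn G s x y) : ReachIn G s y x := by
  obtain ⟨p, hp⟩ := h
  exact ⟨p.reverse, by simpa using hp⟩

theorem ReachIn.trans (h : ReachIn G s x y) (h' : ReachIn G s y z) : ReachIn G s x z := by
  obtain ⟨p, hp⟩ := h
  obtain ⟨q, hq⟩ := h'
  refine ⟨p.append q, fun v hv => ?_⟩
  rcases (SimpleGraph.Walk.mem_support_append_iff _ _).1 hv with h | h
  exacts [hp v h, hq v h]

theorem ReachIn.of_adj (h : G.Adj x y) (hx : x ∈ s) (hy : y ∈ s) : ReachIn G s x y :=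
  ⟨h.toWalk, by simp [hx, hy]⟩

theorem compIn_subset : compIn G s x ⊆ s := fun _ h => h.right_mem

theorem compIn_eq_of_mem (h : y ∈ compIn G s x) : compIn G s y = compIn G s x := by
  ext z
  exact ⟨fun hz => h.trans hz, fun hz => (ReachIn.symm h).trans hz⟩

theorem connIn_compIn (hx : x ∈ s) : ConnIn G (compIn G s x) := by
  have key : ∀ y ∈ compIn G s x, ReachIn G (compIn G s x) x y := by
    classical
    rintro y ⟨p, hp⟩
    exact ⟨p, fun v hv => ⟨p.takeUntil v hv,
      fun u hu => hp u (p.support_takeUntil_subset_support hv hu)⟩⟩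
  exact ⟨⟨x, ReachIn.refl hx⟩, fun y hy z hz => (key y hy).symm.trans (key z hz)⟩

/-- Deleting either of two vertices `r`, `v` of a connected set leaves every vertex attached
to the other one. -/
theorem ConnIn.reachIn_or (hs : ConnIn G s) {r v : V} (hr : r ∈ s) (hv : v ∈ s) (hne : v ≠ r)
    (hy : y ∈ s) : ReachIn G (s \ {v}) r y ∨ ReachIn G (s \ {r}) v y := by
  have walk : ∀ {a b : V} (p : G.Walk a b), (∀ u ∈ p.support, u ∈ s) →
      (ReachIn G (s \ {v}) r a ∨ ReachIn G (s \ {r}) v a) →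
      (ReachIn G (s \ {v}) r b ∨ ReachIn G (s \ {r}) v b) := by
    intro a b p
    induction p with
    | nil => exact fun _ h => h
    | @cons a c b hac p ih =>
      intro hp h
      have hc : c ∈ s := hp c (by simp)
      refine ih (fun u hu => hp u (by simp [hu])) ?_
      rcases h with h | h
      · by_cases hcv : c = v
        · subst hcv
          exact Or.inr (.refl ⟨hc, hne⟩)
        · exact Or.inl (h.trans (.of_adj hac h.right_mem ⟨hc, hcv⟩))
      · by_cases hcr : c = r
        · subst hcr
          exact Or.inl (.refl ⟨hc, hne.symm⟩)
        · exact Or.inr (h.trans (.of_adj hac h.right_mem ⟨hc, hcr⟩))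
  obtain ⟨p, hp⟩ := hs.2 r hr y hy
  exact walk p hp (Or.inl (.refl ⟨hr, hne.symm⟩))

end Reach

section Weights

theorem wsum_singleton {w : V → ℝ} (x : V) : wsum w {x} = w x := finsum_mem_singleton

variable [Finite V] {w : V → ℝ} {s t : Set V}

theorem wsum_mono (hw : ∀ x, 0 ≤ w x) (h : s ⊆ t) : wsum w s ≤ wsum w t := by
  have := Fintype.ofFinite V
  classical
  simp only [wsum, finsum_mem_eq_toFinset_sum]
  exact Finset.sum_le_sum_of_subset_of_nonneg (Set.toFinset_mono h) fun x _ _ => hw x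

theorem wsum_diff_add (h : s ⊆ t) : wsum w (t \ s) + wsum w s = wsum w t := by
  rw [add_comm]
  exact finsum_mem_add_sdiff h (Set.toFinite _)

theorem wsum_add_smul (p : V → ℝ) (δ : ℝ) :
    wsum (fun x => w x + δ * p x) s = wsum w s + δ * wsum p s := by
  simp only [wsum]
  rw [finsum_mem_add_distrib (Set.toFinite _), mul_finsum_mem]

/-- A vertex all of whose components have strictly less than half the weight is the only
centroid. -/
theorem IsCentroid.eq_of_strict {G : SimpleGraph V} (hw : ∀ x, 0 ≤ w x) (hs : ConnIn G s)
    {r v : V} (hr : r ∈ s)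
    (hstrict : ∀ x ∈ s \ {r}, wsum w (compIn G (s \ {r}) x) < wsum w s / 2)
    (hv : IsCentroid G w s v) : v = r := by
  by_contra hne
  have hsub : s \ compIn G (s \ {r}) v ⊆ compIn G (s \ {v}) r := fun y hy =>
    (hs.reachIn_or hr hv.1 hne hy.1).resolve_right hy.2
  have h1 := wsum_mono hw hsub
  have h2 := hv.2 r ⟨hr, Ne.symm hne⟩
  have h3 := hstrict v ⟨hv.1, hne⟩
  have h4 := wsum_diff_add (w := w) (s := compIn G (s \ {r}) v) (t := s)
    (compIn_subset.trans Set.sdiff_subset)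
  linarith

end Weights

namespace IsSearchTree

variable {G : SimpleGraph V} {s : Set V} {T t u : RTree V}

theorem vertSet_eq (h : IsSearchTree G s T) : T.vertSet = s := by
  cases h with
  | node _ h _ _ => exact h

theorem root_mem (h : IsSearchTree G s T) : T.root ∈ s :=
  h.vertSet_eq ▸ T.root_mem_vertSet

theorem isSearchTree_vertSet (h : IsSearchTree G s T) (ht : t ∈ T.allSubtrees) :
    IsSearchTree G t.vertSet t := by
  induction h with
  | node hr hv hts hp ih =>
    rcases RTree.mem_allSubtrees_node.1 ht with rfl | ⟨c, hc, ht⟩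
    · rw [hv]
      exact .node hr hv hts hp
    · exact ih c hc ht

theorem allSubtrees_subset (h : IsSearchTree G s T) (ht : t ∈ T.allSubtrees) :
    t.allSubtrees ⊆ T.allSubtrees := by
  induction h with
  | node hr hv hts hp ih =>
    rcases RTree.mem_allSubtrees_node.1 ht with rfl | ⟨c, hc, ht⟩
    · exact List.Subset.refl _
    · exact fun u hu => RTree.mem_allSubtrees_node.2 (Or.inr ⟨c, hc, ih c hc ht hu⟩)

theorem vertSet_subset (h : IsSearchTree G s T) (ht : t ∈ T.allSubtrees) : t.vertSet ⊆ s := by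
  induction h with
  | node hr hv hts hp ih =>
    rcases RTree.mem_allSubtrees_node.1 ht with rfl | ⟨c, hc, ht⟩
    · exact hv.le
    · exact (ih c hc ht).trans (compIn_subset.trans Set.sdiff_subset)

/-- A subtree of a search tree is determined by its root. -/
theorem eq_of_root_eq (h : IsSearchTree G s T) (ht : t ∈ T.allSubtrees)
    (hu : u ∈ T.allSubtrees) (htu : t.root = u.root) : t = u := by
  induction h with
  | @node s r ts hr hv hts hp ih =>
    have hroot : ∀ c ∈ ts, ∀ a ∈ c.allSubtrees, a.root ∈ compIn G (s \ {r}) c.root :=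
      fun c hc a ha => (hts c hc).vertSet_subset ha a.root_mem_vertSet
    rcases RTree.mem_allSubtrees_node.1 ht with rfl | ⟨c, hc, ht⟩ <;>
      rcases RTree.mem_allSubtrees_node.1 hu with rfl | ⟨d, hd, hu⟩
    · rfl
    · exact absurd htu.symm (compIn_subset (hroot d hd u hu)).2
    · exact absurd htu (compIn_subset (hroot c hc t ht)).2
    · have hcd : c = d := by
        by_contra hne
        have : Std.Symm fun t₁ t₂ : RTree V =>
            compIn G (s \ {r}) t₁.root ≠ compIn G (s \ {r}) t₂.root := ⟨fun _ _ h => h.symm⟩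
        refine hp.forall hc hd hne ?_
        rw [← compIn_eq_of_mem (hroot c hc t ht), ← compIn_eq_of_mem (hroot d hd u hu), htu]
      subst hcd
      exact ih c hc ht hu

theorem exists_subtree_of_mem (h : IsSearchTree G s T) {z : V} (hz : z ∈ s) :
    ∃ u ∈ T.allSubtrees, u.root = z ∧ (z ≠ T.root → u.vertSet ⊆ s \ {T.root}) := by
  induction h with
  | @node s r ts hr hv hts hp ih =>
    rw [← hv] at hz
    rcases RTree.mem_vertSet_node.1 hz with rfl | ⟨c, hc, hz⟩
    · exact ⟨_, RTree.self_mem_allSubtrees _, rfl, fun h => absurd rfl h⟩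
    · rw [(hts c hc).vertSet_eq] at hz
      obtain ⟨u, hu, hroot, -⟩ := ih c hc hz
      exact ⟨u, RTree.mem_allSubtrees_node.2 (Or.inr ⟨c, hc, hu⟩), hroot,
        fun _ => ((hts c hc).vertSet_subset hu).trans compIn_subset⟩

/-- The vertices of a search tree admit a height function decreasing towards the leaves. -/
theorem exists_height [Finite V] (h : IsSearchTree G s T) :
    ∃ f : V → ℕ, ∀ t ∈ T.allSubtrees, ∀ z ∈ t.vertSet \ {t.root}, f z < f t.root := by
  have key : ∀ t ∈ T.allSubtrees,
      {z | ∃ u ∈ T.allSubtrees, u.root = t.root ∧ z ∈ u.vertSet} = t.vertSet := by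
    intro t ht
    ext z
    constructor
    · rintro ⟨u, hu, hroot, hz⟩
      exact h.eq_of_root_eq hu ht hroot ▸ hz
    · exact fun hz => ⟨t, ht, rfl, hz⟩
  refine ⟨fun x => {z | ∃ u ∈ T.allSubtrees, u.root = x ∧ z ∈ u.vertSet}.ncard, ?_⟩
  rintro t ht z ⟨hz, hzr⟩
  obtain ⟨u, hu, rfl, hsub⟩ := (h.isSearchTree_vertSet ht).exists_subtree_of_mem hz
  dsimp only
  rw [key t ht, key u (h.allSubtrees_subset ht hu)]
  exact Set.ncard_lt_ncard ⟨(hsub hzr).trans Set.sdiff_subset,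
    fun hle => (hsub hzr (hle t.root_mem_vertSet)).2 rfl⟩ (Set.toFinite _)

/-- There is a weight function in which every vertex outweighs its proper descendants. -/
theorem exists_dominating_weight [Finite V] (h : IsSearchTree G s T) :
    ∃ p : V → ℝ, (∀ x, 0 ≤ p x) ∧
      ∀ t ∈ T.allSubtrees, wsum p (t.vertSet \ {t.root}) < p t.root := by
  have := Fintype.ofFinite V
  classical
  obtain ⟨f, hf⟩ := h.exists_height
  set K : ℝ := Fintype.card V + 1 with hK
  have hK1 : 1 ≤ K := by simp [hK]
  refine ⟨fun x => K ^ f x, fun x => by positivity, fun t ht => ?_⟩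
  have hpos : 0 < K ^ f t.root := by positivity
  have hsum : K * wsum (fun x => K ^ f x) (t.vertSet \ {t.root})
      ≤ Fintype.card V * K ^ f t.root := by
    rw [wsum, finsum_mem_eq_toFinset_sum, Finset.mul_sum]
    refine (Finset.sum_le_card_nsmul _ _ (K ^ f t.root) fun z hz => ?_).trans ?_
    · rw [← pow_succ']
      exact pow_le_pow_right₀ hK1 (hf t ht z (Set.mem_toFinset.1 hz))
    · rw [nsmul_eq_mul]
      gcongr
      exact Finset.card_le_univ _
  have hlt : (Fintype.card V : ℝ) * K ^ f t.root < K * K ^ f t.root := by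
    gcongr
    simp [hK]
  exact lt_of_mul_lt_mul_left (hsum.trans_lt hlt) (by positivity)

theorem exists_child_compIn_eq {r v : V} {ts : List (RTree V)}
    (h : IsSearchTree G s (.node r ts)) (hv : v ∈ s \ {r}) :
    ∃ t ∈ ts, IsSearchTree G (compIn G (s \ {r}) v) t := by
  cases h with
  | node hr hvs hts hp =>
    have hvm := hv.1
    rw [← hvs] at hvm
    rcases RTree.mem_vertSet_node.1 hvm with rfl | ⟨t, ht, hvt⟩
    · exact absurd rfl hv.2
    · rw [(hts t ht).vertSet_eq] at hvt
      exact ⟨t, ht, compIn_eq_of_mem hvt ▸ hts t ht⟩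

theorem pathSet_node_subset {r : V} {ts ts' : List (RTree V)}
    (h : ∀ t ∈ ts, ∃ t' ∈ ts', t.vertSet = t'.vertSet ∧ t.Equiv t') (v : V) :
    (RTree.node r ts).pathSet v ⊆ (RTree.node r ts').pathSet v := by
  intro x hx
  rcases RTree.mem_pathSet_node.1 hx with h' | ⟨t, ht, hv, hx⟩
  · exact RTree.mem_pathSet_node.2 (Or.inl h')
  · obtain ⟨t', ht', hvs, he⟩ := h t ht
    exact RTree.mem_pathSet_node.2 (Or.inr ⟨t', ht', hvs ▸ hv, he v ▸ hx⟩)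

/-- A search tree all of whose subtrees are rooted at strict centroids is the only
centroid tree. -/
theorem equiv_of_strict [Finite V] {w : V → ℝ} (hw : ∀ x, 0 ≤ w x)
    (h : IsSearchTree G s T) (hs : ConnIn G s)
    (hstrict : ∀ t ∈ T.allSubtrees, ∀ x ∈ t.vertSet \ {t.root},
      wsum w (compIn G (t.vertSet \ {t.root}) x) < wsum w t.vertSet / 2)
    {T' : RTree V} (h' : IsSearchTree G s T')
    (hcent : ∀ t ∈ T'.allSubtrees, IsCentroid G w t.vertSet t.root) : T'.Equiv T := by
  induction h generalizing T' with
  | @node s r ts hr hv hts hp ih =>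
    have hT : IsSearchTree G s (.node r ts) := .node hr hv hts hp
    obtain ⟨r', ts'⟩ := T'
    have hc := hcent _ (RTree.self_mem_allSubtrees _)
    have hst := hstrict _ (RTree.self_mem_allSubtrees _)
    rw [h'.vertSet_eq] at hc
    rw [hv] at hst
    obtain rfl : r' = r := hc.eq_of_strict hw hs hr hst
    have pair : ∀ t ∈ ts, ∀ t' ∈ ts', IsSearchTree G (compIn G (s \ {r'}) t.root) t' →
        t'.vertSet = t.vertSet ∧ t'.Equiv t := fun t ht t' ht' h =>
      ⟨h.vertSet_eq.trans (hts t ht).vertSet_eq.symm,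
        ih t ht (connIn_compIn (hts t ht).root_mem.left_mem)
          (fun u hu => hstrict u (RTree.mem_allSubtrees_node.2 (Or.inr ⟨t, ht, hu⟩))) h
          (fun u hu => hcent u (RTree.mem_allSubtrees_node.2 (Or.inr ⟨t', ht', hu⟩)))⟩
    refine fun v => (pathSet_node_subset (fun t' ht' => ?_) v).antisymm
      (pathSet_node_subset (fun t ht => ?_) v)
    · cases h' with
      | node _ _ hts' _ =>
        obtain ⟨t, ht, hsearch⟩ := hT.exists_child_compIn_eq (hts' t' ht').root_mem.left_mem
        exact ⟨t, ht, pair t ht t' ht' (compIn_eq_of_mem hsearch.root_mem ▸ hts' t' ht')⟩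
    · obtain ⟨t', ht', hsearch⟩ := h'.exists_child_compIn_eq (hts t ht).root_mem.left_mem
      obtain ⟨h1, h2⟩ := pair t ht t' ht' hsearch
      exact ⟨t', ht', h1.symm, fun v => (h2 v).symm⟩

end IsSearchTree

/-- Adding a positive multiple of a dominating weight makes a centroid strict. -/
theorem IsCentroid.strict_add_smul [Finite V] {G : SimpleGraph V} {w p : V → ℝ} {s : Set V}
    {r : V} (h : IsCentroid G w s r) (hp : ∀ x, 0 ≤ p x) (hdom : wsum p (s \ {r}) < p r)
    {δ : ℝ} (hδ : 0 < δ) : ∀ x ∈ s \ {r},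
      wsum (fun y => w y + δ * p y) (compIn G (s \ {r}) x)
        < wsum (fun y => w y + δ * p y) s / 2 := by
  intro x hx
  rw [wsum_add_smul, wsum_add_smul]
  have h1 := h.2 x hx
  have h2 : wsum p (compIn G (s \ {r}) x) ≤ wsum p (s \ {r}) := wsum_mono hp compIn_subset
  have h3 := wsum_diff_add (w := p) (Set.singleton_subset_iff.2 h.1)
  rw [wsum_singleton] at h3
  have h4 : wsum p (compIn G (s \ {r}) x) < wsum p s / 2 := by linarith
  have h5 := mul_lt_mul_of_pos_left h4 hδ
  linarith

theorem tie_breaking {V : Type} [Fintype V]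
    (G : SimpleGraph V) (hG : G.IsTree) (w : V → ℝ) (hw : ∀ x, 0 ≤ w x)
    (C : RTree V) (hC : IsCentroidTree G w Set.univ C)
    (ε : ℝ) (hε : 0 < ε) :
    ∃ w' : V → ℝ, (∀ x, 0 ≤ w' x) ∧
      IsCentroidTree G w' Set.univ C ∧
      (∀ C' : RTree V, IsCentroidTree G w' Set.univ C' → RTree.Equiv C' C) ∧
      (∀ x, |w' x - w x| < ε) := by
  obtain ⟨p, hp, hdom⟩ := hC.1.exists_dominating_weight
  have hM : 0 < ∑ x, p x + 1 := by
    have := Finset.sum_nonneg fun x (_ : x ∈ Finset.univ) => hp x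
    linarith
  set δ : ℝ := ε / (∑ x, p x + 1) with hδ_def
  have hδ : 0 < δ := div_pos hε hM
  have hw' : ∀ x, 0 ≤ w x + δ * p x := fun x => add_nonneg (hw x) (mul_nonneg hδ.le (hp x))
  have hstrict := fun t ht => (hC.2 t ht).strict_add_smul hp (hdom t ht) hδ
  have hconn : ConnIn G Set.univ :=
    ⟨⟨C.root, trivial⟩, fun x _ y _ =>
      (hG.connected.preconnected x y).elim fun q => ⟨q, fun _ _ => trivial⟩⟩
  refine ⟨fun x => w x + δ * p x, hw',
    ⟨hC.1, fun t ht => ⟨t.root_mem_vertSet, fun x hx => (hstrict t ht x hx).le⟩⟩,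
    fun C' hC' => hC.1.equiv_of_strict hw' hconn hstrict hC'.1 hC'.2, fun x => ?_⟩
  rw [add_sub_cancel_left, abs_of_nonneg (mul_nonneg hδ.le (hp x)), hδ_def, div_mul_eq_mul_div,
    div_lt_iff₀ hM]
  have := Finset.single_le_sum (fun y _ => hp y) (Finset.mem_univ x)
  exact mul_lt_mul_of_pos_left (by linarith) hε
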